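/- arXiv:2508.06612 — 4 statements merged into one kernel-verified Lean document; each statement's English description precedes it below -/
import Mathlib

section
/- Entanglement bottlenecks bound the total entanglement by independent pyramids: let m ≥ 1, ℓ ≥ 1, and x = m·ℓ + (m−1), and let n : {0,…,x−1} → ℕ be an admissible entanglement profile that additionally vanishes at the m−1 bottleneck bonds b_j = j·(ℓ+1) − 1 for j = 1,…,m−1. Then ∑_{a=0}^{x-1} n(a) ≤ m · 𝒩(ℓ), where 𝒩(ℓ) = ∑_{a=0}^{ℓ-1} min(a+1, ℓ−a). -/
/-- An admissible entanglement profile on a chain with `x` bonds: the quantized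
entanglement `n a` satisfies `n 0 ≤ 1`, `n (x-1) ≤ 1`, and `|n (a+1) - n a| ≤ 1`
for all `0 ≤ a ≤ x - 2`. -/
def Admissible (x : ℕ) (n : ℕ → ℕ) : Prop :=
  n 0 ≤ 1 ∧ n (x - 1) ≤ 1 ∧ ∀ a, a + 2 ≤ x → |(n (a + 1) : ℤ) - (n a : ℤ)| ≤ 1

/-- A sequence with unit-bounded increments is bounded by its initial value plus the elapsed
number of steps, and by its final value plus the remaining number of steps. -/
theorem le_add_of_unit_steps {g : ℕ → ℕ} {N : ℕ}
    (hg : ∀ k < N, g (k + 1) ≤ g k + 1 ∧ g k ≤ g (k + 1) + 1) (s i : ℕ) (h : s + i ≤ N) :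
    g (s + i) ≤ g s + i ∧ g s ≤ g (s + i) + i := by
  induction i with
  | zero => simp
  | succ i ih =>
    have h₁ := ih (by omega)
    have h₂ := hg (s + i) (by omega)
    rw [← add_assoc]
    omega

/-- A sequence with unit-bounded increments vanishing at the multiples of `L` has total at most
that of one pyramid per block of length `L`. -/
theorem sum_le_pyramids {g : ℕ → ℕ} (L m : ℕ)
    (hg : ∀ k < m * L, g (k + 1) ≤ g k + 1 ∧ g k ≤ g (k + 1) + 1)
    (h0 : ∀ j ≤ m, g (j * L) = 0) :
    ∑ k ∈ Finset.range (m * L), g k ≤ m * ∑ i ∈ Finset.range L, min i (L - i) := by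
  induction m with
  | zero => simp
  | succ m ih =>
    have hmul : (m + 1) * L = m * L + L := by ring
    rw [hmul] at hg
    rw [hmul, Finset.sum_range_add, add_one_mul]
    refine add_le_add (ih (fun k hk => hg k (by omega)) fun j hj => h0 j (by omega)) ?_
    refine Finset.sum_le_sum fun i hi => ?_
    have hi' := Finset.mem_range.mp hi
    have hl := (le_add_of_unit_steps hg (m * L) i (by omega)).1
    have hr := (le_add_of_unit_steps hg (m * L + i) (L - i) (by omega)).2
    have hs := h0 m (by omega)
    have he := h0 (m + 1) le_rfl
    rw [hmul] at he
    rw [show m * L + i + (L - i) = m * L + L by omega, he] at hr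
    omega

/-- Entanglement bottlenecks bound the total entanglement by `m` independent pyramids:
if the chain of `x = m·ℓ + (m-1)` bonds carries an admissible profile vanishing at the
`m-1` bottleneck bonds `j·(ℓ+1) - 1`, then `∑ n ≤ m · 𝒩(ℓ)`. -/
theorem stmt_5 (m ℓ : ℕ) (hm : 1 ≤ m) (hℓ : 1 ≤ ℓ) (x : ℕ) (hx : x = m * ℓ + (m - 1))
    (n : ℕ → ℕ) (hn : Admissible x n)
    (hb : ∀ j, 1 ≤ j → j ≤ m - 1 → n (j * (ℓ + 1) - 1) = 0) :
    ∑ a ∈ Finset.range x, n a ≤ m * ∑ a ∈ Finset.range ℓ, min (a + 1) (ℓ - a) := by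
  obtain ⟨hfirst, hlast, hstep⟩ := hn
  have hx1 : x + 1 = m * (ℓ + 1) := by rw [mul_add_one]; omega
  have hxpos : 1 ≤ x := by
    have := Nat.mul_le_mul hm hℓ
    omega
  let g : ℕ → ℕ := fun k => if k = 0 ∨ x < k then 0 else n (k - 1)
  have hsucc : ∀ a < x, g (a + 1) = n a := fun a ha => by
    simp [g, show ¬ x < a + 1 by omega]
  have hg0 : g 0 = 0 := by simp [g]
  have hgx : g (x + 1) = 0 := by simp [g]
  have hg : ∀ k < m * (ℓ + 1), g (k + 1) ≤ g k + 1 ∧ g k ≤ g (k + 1) + 1 := by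
    intro k hk
    rw [← hx1] at hk
    rcases k with _ | a
    · rw [hsucc 0 hxpos, hg0]
      omega
    · rw [hsucc a (by omega)]
      rcases Nat.lt_or_ge (a + 1) x with h | h
      · rw [hsucc (a + 1) h]
        have := abs_le.mp (hstep a (by omega))
        omega
      · obtain rfl : x = a + 1 := by omega
        rw [hgx]
        simp only [Nat.add_sub_cancel] at hlast
        omega
  have hzero : ∀ j ≤ m, g (j * (ℓ + 1)) = 0 := by
    intro j hj
    rcases Nat.eq_zero_or_pos j with rfl | hpos
    · simp [g]
    · rcases Nat.lt_or_ge j m with h | h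
      · have := hb j hpos (by omega)
        simp [g, this]
      · obtain rfl : j = m := by omega
        rw [← hx1, hgx]
  have key := sum_le_pyramids (ℓ + 1) m hg hzero
  rw [← hx1, Finset.sum_range_succ', hg0, Finset.sum_range_succ' _ ℓ] at key
  rw [Finset.sum_congr rfl fun a ha => hsucc a (Finset.mem_range.mp ha)] at key
  simpa using key
end

section
/- The common +1 eigenspace of k independent commuting stabilizers on N qubits has dimension 2^{N−k}: under the stated hypotheses on g_1,…,g_k, the subspace {v ∈ ℂ^{2^N} : g_i v = v for all i = 1,…,k} has dimension 2^{N−k}. -/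
/-- If commuting involutions `a i`, acting on `V` through `φ`, have products over nonempty
subsets of trace zero, then the dimension of their common fixed space times `2 ^ card ι`
is the dimension of `V`. -/
theorem finrank_iInf_ker_sub_id_mul_two_pow {ι K A V : Type*} [Fintype ι] [Field K] [CharZero K]
    [CommRing A] [Algebra K A] [AddCommGroup V] [Module K V] [FiniteDimensional K V]
    (φ : A →ₐ[K] Module.End K V) (a : ι → A) (hsq : ∀ i, a i * a i = 1)
    (htr : ∀ S : Finset ι, S.Nonempty → LinearMap.trace K V (φ (∏ i ∈ S, a i)) = 0) :
    Module.finrank K ↥(⨅ i, LinearMap.ker (φ (a i) - LinearMap.id)) * 2 ^ Fintype.card ι =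
      Module.finrank K V := by
  classical
  set P : A := (2⁻¹ : K) ^ Fintype.card ι • ∏ i, (1 + a i) with hP
  have mem_iff (v : V) : v ∈ (⨅ i, LinearMap.ker (φ (a i) - LinearMap.id)) ↔
      ∀ i, φ (a i) v = v := by
    simp [Submodule.mem_iInf, sub_eq_zero]
  have mul_P (i : ι) : a i * P = P := by
    rw [hP, mul_smul_comm, ← Finset.mul_prod_erase _ _ (Finset.mem_univ i), ← mul_assoc,
      mul_add, mul_one, hsq, add_comm (a i)]
  have hproj : LinearMap.IsProj (⨅ i, LinearMap.ker (φ (a i) - LinearMap.id)) (φ P) := by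
    refine ⟨fun v => (mem_iff _).2 fun i => ?_, fun v hv => ?_⟩
    · rw [← Module.End.mul_apply, ← map_mul, mul_P]
    · rw [mem_iff] at hv
      have hprod (S : Finset ι) : φ (∏ i ∈ S, (1 + a i)) v = (2 : K) ^ S.card • v := by
        induction S using Finset.induction_on with
        | empty => simp
        | insert i S hi ih =>
          rw [Finset.prod_insert hi, map_mul, Module.End.mul_apply, ih, map_smul, map_add,
            map_one, LinearMap.add_apply, Module.End.one_apply, hv, ← two_smul K v, smul_smul,
            Finset.card_insert_of_notMem hi, pow_succ]
      rw [hP, map_smul, LinearMap.smul_apply, hprod, smul_smul, Finset.card_univ, ← mul_pow]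
      simp
  have htrace : LinearMap.trace K V (φ P) =
      (2⁻¹ : K) ^ Fintype.card ι * Module.finrank K V := by
    rw [hP, map_smul, map_smul, Finset.prod_one_add, map_sum, map_sum,
      Finset.sum_eq_single ∅ (fun S _ hS => htr S (Finset.nonempty_iff_ne_empty.2 hS)) (by simp)]
    simp
  have h := hproj.trace.symm.trans htrace
  have h2 : (Module.finrank K ↥(⨅ i, LinearMap.ker (φ (a i) - LinearMap.id)) : K) *
      2 ^ Fintype.card ι = Module.finrank K V := by
    rw [h, mul_right_comm, ← mul_pow]
    simp
  exact_mod_cast h2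

/-- The common `+1` eigenspace of `k ≤ N` pairwise commuting, independent stabilizer
generators on `N` qubits, i.e. the subspace `{v | g i *ᵥ v = v for all i}`, has
dimension `2^(N-k)`. -/
theorem stmt_10 (N k : ℕ) (hk : k ≤ N)
    (g : Fin k → Matrix (Fin (2 ^ N)) (Fin (2 ^ N)) ℂ)
    (hcomm : ∀ i j, Commute (g i) (g j))
    (hsq : ∀ i, g i * g i = 1)
    (htr : ∀ S : Finset (Fin k), S.Nonempty →
      Matrix.trace (((S.sort (· ≤ ·)).map g).prod) = 0) :
    Module.finrank ℂ
      ↥(⨅ i : Fin k,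
        LinearMap.ker ((g i).mulVecLin - (LinearMap.id : (Fin (2 ^ N) → ℂ) →ₗ[ℂ] _))) =
      2 ^ (N - k) := by
  have hrange : ∀ x ∈ Set.range g, ∀ y ∈ Set.range g, x * y = y * x := by
    rintro _ ⟨i, rfl⟩ _ ⟨j, rfl⟩
    exact hcomm i j
  have : IsMulCommutative (Algebra.adjoin ℂ (Set.range g)) :=
    Algebra.isMulCommutative_adjoin ℂ hrange
  let : CommRing (Algebra.adjoin ℂ (Set.range g)) :=
    { (inferInstance : Ring (Algebra.adjoin ℂ (Set.range g))) with mul_comm := mul_comm' }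
  let a : Fin k → Algebra.adjoin ℂ (Set.range g) :=
    fun i => ⟨g i, Algebra.subset_adjoin (Set.mem_range_self i)⟩
  let φ : Algebra.adjoin ℂ (Set.range g) →ₐ[ℂ] Module.End ℂ (Fin (2 ^ N) → ℂ) :=
    (Matrix.toLinAlgEquiv' : _ ≃ₐ[ℂ] _).toAlgHom.comp (Algebra.adjoin ℂ (Set.range g)).val
  have hprod (S : Finset (Fin k)) :
      ((∏ i ∈ S, a i : Algebra.adjoin ℂ (Set.range g)) : Matrix _ _ ℂ) =
        ((S.sort (· ≤ ·)).map g).prod := by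
    have hlist : ((S.sort (· ≤ ·)).map a).prod = ∏ i ∈ S, a i := by
      rw [← List.prod_toFinset a (S.sort_nodup (· ≤ ·)), Finset.sort_toFinset]
    rw [← hlist]
    exact (map_list_prod (Algebra.adjoin ℂ (Set.range g)).val _).trans (by
      rw [List.map_map]; rfl)
  have h := finrank_iInf_ker_sub_id_mul_two_pow φ a (fun i => Subtype.ext (hsq i))
    fun S hS => by
      change LinearMap.trace ℂ _ (Matrix.toLin' (∏ i ∈ S, a i).1) = 0
      rw [Matrix.trace_toLin'_eq, hprod, htr S hS]
  rw [Fintype.card_fin, Module.finrank_fin_fun] at h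
  refine Nat.eq_of_mul_eq_mul_right (pow_pos two_pos k) (Eq.trans h ?_)
  rw [← pow_add, Nat.sub_add_cancel hk]
end

section
/- N independent commuting stabilizers on N qubits determine a unique state: under the stated hypotheses with k = N, the subspace {v ∈ ℂ^{2^N} : g_i v = v for all i = 1,…,N} is one-dimensional; i.e., there is a stabilized vector that is unique up to scalar multiple. -/
universe u

open Matrix
open scoped IsMulCommutative

/-- A pairwise commuting family in an algebra lifts to a commutative algebra. -/
theorem exists_commRing_algHom_lift {ι R : Type*} {B : Type u} [CommRing R] [Ring B] [Algebra R B]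
    (g : ι → B) (hcomm : ∀ i j, Commute (g i) (g j)) :
    ∃ (A : Type u) (_ : CommRing A) (_ : Algebra R A) (φ : A →ₐ[R] B) (G : ι → A),
      Function.Injective φ ∧ ∀ i, φ (G i) = g i := by
  have h : ∀ a ∈ Set.range g, ∀ b ∈ Set.range g, a * b = b * a := by
    rintro _ ⟨i, rfl⟩ _ ⟨j, rfl⟩
    exact hcomm i j
  have := Algebra.isMulCommutative_adjoin R h
  exact ⟨Algebra.adjoin R (Set.range g), inferInstance,
    Subalgebra.algebra _, (Algebra.adjoin R (Set.range g)).val,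
    fun i => ⟨g i, Algebra.subset_adjoin ⟨i, rfl⟩⟩, Subtype.val_injective, fun _ => rfl⟩

theorem Finset.prod_map_sort {ι M : Type*} [LinearOrder ι] [CommMonoid M] (S : Finset ι)
    (f : ι → M) : ((S.sort (· ≤ ·)).map f).prod = ∏ i ∈ S, f i := by
  rw [Finset.prod_eq_multiset_prod, ← Multiset.prod_coe, ← Multiset.map_coe, Finset.sort_eq]

/-- The common fixed space of commuting involutions is the range of a projection whose trace is the
average of the traces of their products. -/
theorem exists_isProj_iInf_ker_sub_id {n k : ℕ} (g : Fin k → Matrix (Fin n) (Fin n) ℂ)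
    (hcomm : ∀ i j, Commute (g i) (g j)) (hsq : ∀ i, g i * g i = 1) :
    ∃ P : Matrix (Fin n) (Fin n) ℂ,
      LinearMap.IsProj (⨅ i, LinearMap.ker ((g i).mulVecLin - LinearMap.id)) P.toLin' ∧
      P.trace = (2⁻¹ : ℂ) ^ k *
        ∑ S : Finset (Fin k), (((S.sort (· ≤ ·)).map g).prod).trace := by
  obtain ⟨A, _, _, φ, G, hφ, hG⟩ := exists_commRing_algHom_lift (R := ℂ) g hcomm
  have hGsq : ∀ i, G i * G i = 1 := fun i => hφ (by simp [hG, hsq])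
  set p : A := ∏ i, (2⁻¹ : ℂ) • (1 + G i) with hp
  have hmul : ∀ i, G i * p = p := fun i => by
    rw [hp, ← Finset.mul_prod_erase _ _ (Finset.mem_univ i), ← mul_assoc, mul_smul_comm,
      mul_add, hGsq, mul_one, add_comm]
  have hfix : ∀ (x : Fin n → ℂ), (∀ i, g i *ᵥ x = x) → ∀ s : Finset (Fin k),
      φ (∏ i ∈ s, (2⁻¹ : ℂ) • (1 + G i)) *ᵥ x = x := by
    intro x hx s
    induction s using Finset.induction_on with
    | empty => simp
    | insert i s hi ih =>
      rw [Finset.prod_insert hi, map_mul, ← mulVec_mulVec, ih, map_smul, map_add, map_one, hG,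
        smul_mulVec, add_mulVec, one_mulVec, hx, ← two_smul ℂ x, smul_smul]
      norm_num
  refine ⟨φ p, ⟨fun x => ?_, fun x hx => ?_⟩, ?_⟩
  · simp only [Submodule.mem_iInf, LinearMap.mem_ker, LinearMap.sub_apply, mulVecLin_apply,
      LinearMap.id_apply, toLin'_apply, sub_eq_zero]
    intro i
    rw [mulVec_mulVec, ← hG, ← map_mul, hmul]
  · simp only [Submodule.mem_iInf, LinearMap.mem_ker, LinearMap.sub_apply, mulVecLin_apply,
      LinearMap.id_apply, sub_eq_zero] at hx
    exact hfix x hx _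
  · have hprod : ∀ S : Finset (Fin k), ((S.sort (· ≤ ·)).map g).prod = φ (∏ i ∈ S, G i) := by
      intro S
      rw [← Finset.prod_map_sort, map_list_prod, List.map_map]
      congr 2
      exact funext fun i => (hG i).symm
    simp only [hprod]
    rw [hp, Finset.prod_smul, Finset.prod_const, Finset.card_univ, Fintype.card_fin,
      Finset.prod_one_add, map_smul, trace_smul, map_sum, trace_sum, Finset.powerset_univ,
      smul_eq_mul]

/-- `N` pairwise commuting, independent stabilizer generators on `N` qubits determine a
unique state: the common `+1` eigenspace `{v | g i *ᵥ v = v for all i}` is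
one-dimensional, i.e. there is a nonzero stabilized vector that is unique up to a scalar
multiple. -/
theorem stmt_11 (N : ℕ)
    (g : Fin N → Matrix (Fin (2 ^ N)) (Fin (2 ^ N)) ℂ)
    (hcomm : ∀ i j, Commute (g i) (g j))
    (hsq : ∀ i, g i * g i = 1)
    (htr : ∀ S : Finset (Fin N), S.Nonempty →
      Matrix.trace (((S.sort (· ≤ ·)).map g).prod) = 0) :
    Module.finrank ℂ
      ↥(⨅ i : Fin N,
        LinearMap.ker ((g i).mulVecLin - (LinearMap.id : (Fin (2 ^ N) → ℂ) →ₗ[ℂ] _))) = 1 ∧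
    ∃ v : Fin (2 ^ N) → ℂ, v ≠ 0 ∧ (∀ i, (g i).mulVec v = v) ∧
      ∀ w : Fin (2 ^ N) → ℂ, (∀ i, (g i).mulVec w = w) → ∃ c : ℂ, w = c • v := by
  have hdim : Module.finrank ℂ
      ↥(⨅ i : Fin N,
        LinearMap.ker ((g i).mulVecLin - (LinearMap.id : (Fin (2 ^ N) → ℂ) →ₗ[ℂ] _))) = 1 := by
    obtain ⟨P, hP, htrP⟩ := exists_isProj_iInf_ker_sub_id g hcomm hsq
    have h := hP.trace
    rw [trace_toLin'_eq, htrP, Finset.sum_eq_single ∅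
      (fun S _ hS => htr S (Finset.nonempty_iff_ne_empty.mpr hS)) (by simp)] at h
    simp only [Finset.sort_empty, List.map_nil, List.prod_nil, trace_one, Fintype.card_fin,
      Nat.cast_pow, Nat.cast_ofNat, ← mul_pow] at h
    norm_num at h
    exact_mod_cast h.symm
  refine ⟨hdim, ?_⟩
  obtain ⟨⟨v, hv⟩, hv0, hspan⟩ := finrank_eq_one_iff'.mp hdim
  simp only [Submodule.mem_iInf, LinearMap.mem_ker, LinearMap.sub_apply, mulVecLin_apply,
    LinearMap.id_apply, sub_eq_zero] at hv
  refine ⟨v, fun h => hv0 (Subtype.ext h), hv, fun w hw => ?_⟩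
  obtain ⟨c, hc⟩ := hspan ⟨w, by simpa [Submodule.mem_iInf, sub_eq_zero] using hw⟩
  exact ⟨c, (congrArg Subtype.val hc).symm⟩
end

section
/- Two Pauli strings either commute or anticommute, with the sign determined by the number of sites where they differ nontrivially: for all f, g : Fin n → Fin 4, σ_f · σ_g = (−1)^{c(f,g)} · σ_g · σ_f, where c(f,g) is the number of sites i with f(i) ≠ 0, g(i) ≠ 0, and f(i) ≠ g(i). -/
/-- The identity and the three Pauli matrices: `σ 0 = I`, `σ 1 = X`, `σ 2 = Y`,
`σ 3 = Z`. -/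
noncomputable def pauli : Fin 4 → Matrix (Fin 2) (Fin 2) ℂ :=
  ![1, !![0, 1; 1, 0], !![0, -Complex.I; Complex.I, 0], !![1, 0; 0, -1]]

/-- The Pauli string `σ_f = ⊗ i, σ (f i)`, the `n`-fold Kronecker product with entries
`(σ_f)_{v,w} = ∏ i, (σ (f i))_{v i, w i}`. -/
noncomputable def pauliString {n : ℕ} (f : Fin n → Fin 4) :
    Matrix (Fin n → Fin 2) (Fin n → Fin 2) ℂ :=
  Matrix.of fun v w => ∏ i, pauli (f i) (v i) (w i)

/-- Two single-site Pauli matrices anticommute if they are distinct and both nontrivial, and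
commute otherwise. -/
theorem pauli_mul_pauli_comm (a b : Fin 4) :
    pauli a * pauli b =
      (if a ≠ 0 ∧ b ≠ 0 ∧ a ≠ b then (-1 : ℂ) else 1) • (pauli b * pauli a) := by
  fin_cases a <;> fin_cases b <;> simp [pauli]

/-- Products of Pauli strings are computed site by site. -/
theorem pauliString_mul_apply {n : ℕ} (f g : Fin n → Fin 4) (v w : Fin n → Fin 2) :
    (pauliString f * pauliString g) v w = ∏ i, (pauli (f i) * pauli (g i)) (v i) (w i) := by
  simp only [Matrix.mul_apply, pauliString, Matrix.of_apply, Fintype.prod_sum,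
    Finset.prod_mul_distrib]

/-- Two Pauli strings either commute or anticommute:
`σ_f · σ_g = (-1)^(c f g) · σ_g · σ_f`, where `c f g` is the number of sites where both
act nontrivially and differ. -/
theorem stmt_14 (n : ℕ) (f g : Fin n → Fin 4) :
    pauliString f * pauliString g =
      ((-1 : ℂ) ^
          (Finset.univ.filter fun i => f i ≠ 0 ∧ g i ≠ 0 ∧ f i ≠ g i).card) •
        (pauliString g * pauliString f) := by
  ext v w
  rw [Matrix.smul_apply, pauliString_mul_apply, pauliString_mul_apply, ← Finset.prod_const,
    Finset.prod_filter, smul_eq_mul, ← Finset.prod_mul_distrib]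
  refine Finset.prod_congr rfl fun i _ => ?_
  rw [pauli_mul_pauli_comm, Matrix.smul_apply, smul_eq_mul]
end
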